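/- Let n ≥ 2 and let x₀, x be unit vectors in ℝⁿ, let r ∈ (0, π/2) with arccos⟨x, x₀⟩ ≤ r, and let C = { z ∈ ℝⁿ : ‖z‖ = 1 and arccos⟨z, x₀⟩ ≤ r } be the closed spherical cap of geodesic radius r around x₀. Let v ∈ ℝⁿ with ⟨v, x⟩ = 0, and suppose x ≠ x₀ and v is not a scalar multiple of x₀ − ⟨x, x₀⟩x. Define F : C → ℝ by F(z) = ⟨v, Log_x(z)⟩, where Log_x(z) = (θ/sin θ)(z − ⟨x, z⟩ x) with θ = arccos⟨x, z⟩ for z ≠ x, and Log_x(x) = 0. Then there exists a maximizer z* of F over C such that ⟨z*, x₀⟩ = cos r and z* lies in the linear span of {x, x₀, v}. -/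

import Mathlib

open RealInnerProductSpace

open scoped Classical

/-- The Riemannian logarithm of the unit sphere at `x`, evaluated at `z`:
`Log_x(z) = (θ / sin θ)(z − ⟪x, z⟫x)` with `θ = arccos⟪x, z⟫` for `z ≠ x`, and
`Log_x(x) = 0`. -/
noncomputable def sphereLog {n : ℕ} (x z : EuclideanSpace ℝ (Fin n)) :
    EuclideanSpace ℝ (Fin n) :=
  if z = x then 0
  else (Real.arccos ⟪x, z⟫ / Real.sin (Real.arccos ⟪x, z⟫)) • (z - ⟪x, z⟫ • x)

lemma sc_sinc_mul (t : ℝ) : Real.sinc t * t = Real.sin t := by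
  by_cases h : t = 0
  · simp [h]
  · rw [Real.sinc_of_ne_zero h]; field_simp

lemma sc_sinc_pos {t : ℝ} (h0 : 0 ≤ t) (h1 : t < Real.pi) : 0 < Real.sinc t := by
  rcases h0.eq_or_lt with h | h
  · simp [← h]
  · rw [Real.sinc_of_ne_zero h.ne']; exact div_pos (Real.sin_pos_of_pos_of_lt_pi h h1) h

lemma sc_log {n : ℕ} (x z v : EuclideanSpace ℝ (Fin n)) (hx : ‖x‖ = 1) (hz : ‖z‖ = 1)
    (hv : ⟪v, x⟫ = 0) :
    ⟪v, sphereLog x z⟫ = (Real.sinc (Real.arccos ⟪x, z⟫))⁻¹ * ⟪v, z⟫ := by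
  unfold sphereLog
  split_ifs with h
  · subst h; simp [hv]
  · have h1 : Real.arccos ⟪x, z⟫ ≠ 0 := by
      intro h2
      rw [Real.arccos_eq_zero] at h2
      have h3 : ⟪x, z⟫ ≤ 1 := by
        have := real_inner_le_norm x z
        rwa [hx, hz, one_mul] at this
      exact h ((inner_eq_one_iff_of_norm_eq_one hx hz).1 (le_antisymm h3 h2)).symm
    rw [Real.sinc_of_ne_zero h1, inv_div, inner_smul_right, inner_sub_right, inner_smul_right, hv]
    simp

/-- The spherical exponential map. -/
noncomputable def scExp {n : ℕ} (x u : EuclideanSpace ℝ (Fin n)) : EuclideanSpace ℝ (Fin n) :=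
  Real.cos ‖u‖ • x + Real.sinc ‖u‖ • u

lemma scExp_cont {n : ℕ} (x : EuclideanSpace ℝ (Fin n)) : Continuous (scExp x) := by
  unfold scExp
  have := Real.continuous_sinc
  fun_prop

lemma scExp_norm {n : ℕ} (x u : EuclideanSpace ℝ (Fin n)) (hx : ‖x‖ = 1) (hu : ⟪x, u⟫ = 0) :
    ‖scExp x u‖ = 1 := by
  have h : ‖scExp x u‖ ^ 2 = 1 := by
    unfold scExp
    rw [norm_add_sq_real, norm_smul, norm_smul, inner_smul_left, inner_smul_right, hu, hx]
    have h1 := sc_sinc_mul ‖u‖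
    have h2 := Real.sin_sq_add_cos_sq ‖u‖
    simp only [mul_pow, Real.norm_eq_abs, sq_abs]
    rw [← h1] at h2
    simp
    linarith
  nlinarith [norm_nonneg (scExp x u)]

lemma scExp_log {n : ℕ} (x u v : EuclideanSpace ℝ (Fin n)) (hx : ‖x‖ = 1) (hu : ⟪x, u⟫ = 0)
    (hv : ⟪v, x⟫ = 0) (hπ : ‖u‖ < Real.pi) :
    ⟪v, sphereLog x (scExp x u)⟫ = ⟪v, u⟫ := by
  rw [sc_log x _ v hx (scExp_norm x u hx hu) hv]
  have h1 : ⟪x, scExp x u⟫ = Real.cos ‖u‖ := by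
    unfold scExp
    rw [inner_add_right, inner_smul_right, inner_smul_right, hu, real_inner_self_eq_norm_sq, hx]
    simp
  have h2 : ⟪v, scExp x u⟫ = Real.sinc ‖u‖ * ⟪v, u⟫ := by
    unfold scExp
    rw [inner_add_right, inner_smul_right, inner_smul_right, hv]
    simp
  rw [h1, h2, Real.arccos_cos (norm_nonneg _) hπ.le]
  have := (sc_sinc_pos (norm_nonneg u) hπ).ne'
  field_simp

lemma scExp_surj {n : ℕ} (x z : EuclideanSpace ℝ (Fin n)) (hx : ‖x‖ = 1) (hz : ‖z‖ = 1)
    (h : -1 < ⟪x, z⟫) : ∃ u, ⟪x, u⟫ = 0 ∧ ‖u‖ < Real.pi ∧ scExp x u = z := by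
  have h3 : ⟪x, z⟫ ≤ 1 := by
    have := real_inner_le_norm x z
    rwa [hx, hz, one_mul] at this
  set θ := Real.arccos ⟪x, z⟫ with hθ
  have hθ0 : 0 ≤ θ := Real.arccos_nonneg _
  have hθπ : θ < Real.pi := by
    refine lt_of_le_of_ne (Real.arccos_le_pi _) ?_
    intro h'
    rw [hθ, Real.arccos_eq_pi] at h'
    linarith
  have hc : Real.cos θ = ⟪x, z⟫ := Real.cos_arccos h.le h3
  have hs := sc_sinc_pos hθ0 hθπ
  have hn : ‖z - ⟪x, z⟫ • x‖ = Real.sin θ := by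
    have h0 : 0 ≤ Real.sin θ := Real.sin_nonneg_of_nonneg_of_le_pi hθ0 hθπ.le
    have : ‖z - ⟪x, z⟫ • x‖ ^ 2 = Real.sin θ ^ 2 := by
      rw [norm_sub_sq_real, norm_smul, inner_smul_right, real_inner_comm x z, hx, hz, Real.sin_sq, hc]
      simp only [mul_pow, Real.norm_eq_abs, sq_abs]
      ring
    exact (sq_eq_sq₀ (norm_nonneg _) h0).1 this
  have hun : ‖(Real.sinc θ)⁻¹ • (z - ⟪x, z⟫ • x)‖ = θ := by
    rw [norm_smul, hn, ← sc_sinc_mul θ, Real.norm_eq_abs, abs_of_pos (inv_pos.2 hs)]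
    field_simp
  refine ⟨(Real.sinc θ)⁻¹ • (z - ⟪x, z⟫ • x), ?_, ?_, ?_⟩
  · rw [inner_smul_right, inner_sub_right, inner_smul_right, real_inner_self_eq_norm_sq, hx]
    simp
  · rw [hun]; exact hθπ
  · unfold scExp
    rw [hun, hc, smul_smul, mul_inv_cancel₀ hs.ne']
    simp

/-- Folding a unit vector into a subspace while only moving along a direction `u`. -/
lemma sc_fold {n : ℕ} (S : Submodule ℝ (EuclideanSpace ℝ (Fin n)))
    (u z : EuclideanSpace ℝ (Fin n)) (huS : u ∈ S) (hu : u ≠ 0) (hz : ‖z‖ = 1) :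
    ∃ z' ∈ S, ‖z'‖ = 1 ∧ ∃ s : ℝ, 0 ≤ s ∧ ∀ y ∈ S, ⟪y, z'⟫ = ⟪y, z⟫ + s * ⟪y, u⟫ := by
  have hp : ‖S.starProjection z‖ ≤ 1 := by
    rw [← hz]; exact S.norm_starProjection_apply_le z
  have hpS : S.starProjection z ∈ S := S.starProjection_apply_mem z
  set p := S.starProjection z with hpdef
  have hun : 0 < ‖u‖ := norm_pos_iff.2 hu
  have hcont : ContinuousOn (fun s : ℝ => ‖p + s • u‖) (Set.Icc 0 (2 / ‖u‖)) := by fun_prop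
  have hb : (1 : ℝ) ≤ ‖p + (2 / ‖u‖) • u‖ := by
    have h1 : ‖(2 / ‖u‖) • u‖ = 2 := by
      rw [norm_smul, Real.norm_eq_abs, abs_of_pos (by positivity)]; field_simp
    have h2 := norm_sub_le (p + (2 / ‖u‖) • u) p
    rw [add_sub_cancel_left, h1] at h2
    linarith
  obtain ⟨s, hs, hs1⟩ := intermediate_value_Icc (by positivity) hcont
    (show (1 : ℝ) ∈ Set.Icc _ _ from ⟨by simpa using hp, hb⟩)
  refine ⟨p + s • u, S.add_mem hpS (S.smul_mem _ huS), hs1, s, hs.1, ?_⟩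
  intro y hy
  have h3 : ⟪y, z - p⟫ = 0 :=
    (Submodule.mem_orthogonal S _).1 (S.sub_starProjection_mem_orthogonal z) y hy
  rw [inner_sub_right] at h3
  rw [inner_add_right, inner_smul_right]
  linarith

/-- Linear minimization over a spherical cap: the function
`F(z) = ⟪v, Log_x(z)⟫` attains a maximum over the closed spherical cap
`C = {z : ‖z‖ = 1, arccos⟪z, x₀⟫ ≤ r}` at some `z*` on the boundary of the cap
(`⟪z*, x₀⟫ = cos r`) lying in the linear span of `{x, x₀, v}`. -/
theorem spherical_cap_linear_oracle {n : ℕ} (hn : 2 ≤ n)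
    (x₀ x : EuclideanSpace ℝ (Fin n)) (hx₀ : ‖x₀‖ = 1) (hx : ‖x‖ = 1)
    (r : ℝ) (hr : r ∈ Set.Ioo 0 (Real.pi / 2))
    (hxr : Real.arccos ⟪x, x₀⟫ ≤ r)
    (v : EuclideanSpace ℝ (Fin n)) (hv : ⟪v, x⟫ = 0)
    (hxx₀ : x ≠ x₀)
    (hvspan : ∀ μ : ℝ, v ≠ μ • (x₀ - ⟪x, x₀⟫ • x)) :
    ∃ zstar ∈ {z : EuclideanSpace ℝ (Fin n) | ‖z‖ = 1 ∧ Real.arccos ⟪z, x₀⟫ ≤ r},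
      (∀ z ∈ {z : EuclideanSpace ℝ (Fin n) | ‖z‖ = 1 ∧ Real.arccos ⟪z, x₀⟫ ≤ r},
          ⟪v, sphereLog x z⟫ ≤ ⟪v, sphereLog x zstar⟫) ∧
        ⟪zstar, x₀⟫ = Real.cos r ∧
        zstar ∈ Submodule.span ℝ ({x, x₀, v} : Set (EuclideanSpace ℝ (Fin n))) := by
  obtain ⟨hr0, hr1⟩ := hr
  have hcr : 0 < Real.cos r := Real.cos_pos_of_mem_Ioo ⟨by linarith, hr1⟩
  have hle1 : ∀ a b : EuclideanSpace ℝ (Fin n), ‖a‖ = 1 → ‖b‖ = 1 → |⟪a, b⟫| ≤ 1 := by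
    intro a b ha hb
    have := abs_real_inner_le_norm a b
    rwa [ha, hb, one_mul] at this
  have hcap : ∀ z : EuclideanSpace ℝ (Fin n), ‖z‖ = 1 → Real.arccos ⟪z, x₀⟫ ≤ r →
      Real.cos r ≤ ⟪z, x₀⟫ := by
    intro z hz h
    have h1 := abs_le.1 (hle1 z x₀ hz hx₀)
    rw [← Real.cos_arccos h1.1 h1.2]
    exact Real.cos_le_cos_of_nonneg_of_le_pi (Real.arccos_nonneg _) (by linarith) h
  have hcap' : ∀ z : EuclideanSpace ℝ (Fin n), Real.cos r ≤ ⟪z, x₀⟫ →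
      Real.arccos ⟪z, x₀⟫ ≤ r := by
    intro z h
    have := Real.arccos_le_arccos h
    rwa [Real.arccos_cos hr0.le (by linarith)] at this
  have hanti : ∀ z : EuclideanSpace ℝ (Fin n), ‖z‖ = 1 → Real.arccos ⟪z, x₀⟫ ≤ r →
      -1 < ⟪x, z⟫ := by
    intro z hz h
    refine lt_of_le_of_ne (abs_le.1 (hle1 x z hx hz)).1 ?_
    intro h'
    have h1 : ⟪x, -z⟫ = 1 := by rw [inner_neg_right, ← h']; norm_num
    have h2 : x = -z := (inner_eq_one_iff_of_norm_eq_one hx (by rwa [norm_neg])).1 h1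
    have h3 := hcap z hz h
    have h4 := hcap x hx hxr
    rw [h2, inner_neg_left] at h4
    linarith
  have hspos : ∀ z : EuclideanSpace ℝ (Fin n), -1 < ⟪x, z⟫ →
      0 < Real.sinc (Real.arccos ⟪x, z⟫) := by
    intro z h
    refine sc_sinc_pos (Real.arccos_nonneg _) (lt_of_le_of_ne (Real.arccos_le_pi _) ?_)
    intro h'
    rw [Real.arccos_eq_pi] at h'
    linarith
  -- existence of a maximizer
  have hcomp : IsCompact {z : EuclideanSpace ℝ (Fin n) | ‖z‖ = 1 ∧ Real.arccos ⟪z, x₀⟫ ≤ r} := by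
    refine (isCompact_sphere (0 : EuclideanSpace ℝ (Fin n)) 1).of_isClosed_subset ?_ ?_
    · refine IsClosed.and (isClosed_eq continuous_norm continuous_const) (isClosed_le ?_ continuous_const)
      exact Real.continuous_arccos.comp (continuous_id.inner continuous_const)
    · intro z hz
      simpa using hz.1
  have hcont : ContinuousOn (fun z => ⟪v, sphereLog x z⟫)
      {z : EuclideanSpace ℝ (Fin n) | ‖z‖ = 1 ∧ Real.arccos ⟪z, x₀⟫ ≤ r} := by
    have : ContinuousOn (fun z => (Real.sinc (Real.arccos ⟪x, z⟫))⁻¹ * ⟪v, z⟫)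
        {z : EuclideanSpace ℝ (Fin n) | ‖z‖ = 1 ∧ Real.arccos ⟪z, x₀⟫ ≤ r} := by
      refine ContinuousOn.mul (ContinuousOn.inv₀ ?_ ?_) ?_
      · exact (Real.continuous_sinc.comp (Real.continuous_arccos.comp
          (continuous_const.inner continuous_id))).continuousOn
      · intro z hz
        exact (hspos z (hanti z hz.1 hz.2)).ne'
      · exact (continuous_const.inner continuous_id).continuousOn
    refine this.congr ?_
    intro z hz
    exact sc_log x z v hx hz.1 hv
  obtain ⟨z, hzC, hzmax⟩ := hcomp.exists_isMaxOn ⟨x, hx, hxr⟩ hcont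
  have hmax : ∀ y, ‖y‖ = 1 → Real.arccos ⟪y, x₀⟫ ≤ r →
      ⟪v, sphereLog x y⟫ ≤ ⟪v, sphereLog x z⟫ := fun y h1 h2 => hzmax ⟨h1, h2⟩
  obtain ⟨hz1, hzr⟩ := hzC
  have hv0 : v ≠ 0 := by simpa using hvspan 0
  -- the maximizer is on the boundary
  have hbd : ⟪z, x₀⟫ = Real.cos r := by
    by_contra hne
    have hlt : Real.cos r < ⟪z, x₀⟫ := lt_of_le_of_ne (hcap z hz1 hzr) (Ne.symm hne)
    obtain ⟨u, hxu, huπ, huz⟩ := scExp_surj x z hx hz1 (hanti z hz1 hzr)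
    have hc1 : Continuous (fun ε : ℝ => u + ε • v) := by fun_prop
    have hc2 : Continuous (fun ε : ℝ => ⟪scExp x (u + ε • v), x₀⟫) :=
      ((scExp_cont x).comp hc1).inner continuous_const
    have e1 : ∀ᶠ ε in nhds (0 : ℝ), ‖u + ε • v‖ < Real.pi :=
      (hc1.norm.tendsto 0).eventually_lt_const (by simpa using huπ)
    have e2 : ∀ᶠ ε in nhds (0 : ℝ), Real.cos r < ⟪scExp x (u + ε • v), x₀⟫ :=
      (hc2.tendsto 0).eventually_const_lt (by simpa [huz] using hlt)
    obtain ⟨δ, hδ, hδ'⟩ := Metric.eventually_nhds_iff.1 (e1.and e2)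
    obtain ⟨h1, h2⟩ := hδ' (y := δ / 2) (by
      rw [Real.dist_eq, sub_zero, abs_of_pos (by positivity)]; linarith)
    have h3 : ⟪x, u + (δ / 2) • v⟫ = 0 := by
      rw [inner_add_right, inner_smul_right, hxu, real_inner_comm, hv]; simp
    have h4 := hmax _ (scExp_norm x _ hx h3) (hcap' _ h2.le)
    rw [scExp_log x _ v hx h3 hv h1, ← huz, scExp_log x _ v hx hxu hv huπ, inner_add_right,
      inner_smul_right] at h4
    have h5 : 0 < ⟪v, v⟫ := real_inner_self_pos.2 hv0
    nlinarith [mul_pos hδ h5]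
  -- fold it into the span
  set w := x₀ - ⟪x, x₀⟫ • x with hw
  set S := Submodule.span ℝ ({x, x₀, v} : Set (EuclideanSpace ℝ (Fin n))) with hS
  have hxS : x ∈ S := Submodule.subset_span (by simp)
  have hx₀S : x₀ ∈ S := Submodule.subset_span (by simp)
  have hvS : v ∈ S := Submodule.subset_span (by simp)
  have hwS : w ∈ S := S.sub_mem hx₀S (S.smul_mem _ hxS)
  set u := v - (⟪w, v⟫ / ⟪w, w⟫) • w with hu
  have huS : u ∈ S := S.sub_mem hvS (S.smul_mem _ hwS)
  have hu0 : u ≠ 0 := fun h => hvspan _ (sub_eq_zero.1 h)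
  have hxw : ⟪x, w⟫ = 0 := by
    rw [hw, inner_sub_right, inner_smul_right, real_inner_self_eq_norm_sq, hx]; simp
  have hxu : ⟪x, u⟫ = 0 := by
    rw [hu, inner_sub_right, inner_smul_right, hxw, real_inner_comm, hv]; simp
  have hwu : ⟪w, u⟫ = 0 := by
    by_cases h : w = 0
    · rw [h]; simp
    · have := (real_inner_self_pos.2 h).ne'
      rw [hu, inner_sub_right, inner_smul_right]
      field_simp
      ring
  have hx₀u : ⟪x₀, u⟫ = 0 := by
    have : x₀ = w + ⟪x, x₀⟫ • x := by rw [hw]; simp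
    rw [this, inner_add_left, inner_smul_left, hwu, hxu]; simp
  have hvu : 0 < ⟪v, u⟫ := by
    have : v = u + (⟪w, v⟫ / ⟪w, w⟫) • w := by rw [hu]; simp
    have h2 : ⟪v, u⟫ = ⟪u, u⟫ := by
      conv_lhs => rw [this]
      rw [inner_add_left, inner_smul_left, hwu]; simp
    rw [h2]
    exact real_inner_self_pos.2 hu0
  obtain ⟨z', hmemS, hnorm1, s, hs, hz'⟩ := sc_fold S u z huS hu0 hz1
  have hbd2 : ⟪z', x₀⟫ = Real.cos r := by
    rw [real_inner_comm, hz' x₀ hx₀S, hx₀u, real_inner_comm, hbd]; simp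
  refine ⟨z', ⟨hnorm1, hcap' _ hbd2.ge⟩, ?_, hbd2, hmemS⟩
  intro y hy
  refine (hmax y hy.1 hy.2).trans ?_
  rw [sc_log x z v hx hz1 hv, sc_log x z' v hx hnorm1 hv, hz' x hxS, hxu, hz' v hvS, mul_zero,
    add_zero]
  have := hspos z (hanti z hz1 hzr)
  refine mul_le_mul_of_nonneg_left ?_ (inv_pos.2 this).le
  have := mul_nonneg hs hvu.le
  linarith
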